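/- arXiv:1705.03153 — 9 statements merged into one kernel-verified Lean document; each statement's English description precedes it below -/
import Mathlib

section
/- Let A be an n×n real matrix with N(A) ∩ R(A) = {0}, let b ∈ R(A), x₀ ∈ ℝⁿ, and r₀ = b − A x₀ with r₀ ≠ 0. Then there exists m with 1 ≤ m ≤ n such that: (i) for every j with 1 ≤ j ≤ m, dim K_j(A, r₀) = j and A restricted to K_j(A, r₀) is injective (equivalently dim A·K_j(A, r₀) = dim K_j(A, r₀), so GMRES does not break down); and (ii) there exists z ∈ K_m(A, r₀) with A z = r₀, and this z is the unique element of R(A) satisfying A z = r₀; hence x₀ + z solves A x = b. -/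
open Matrix Submodule Module

/-- `matE M` : the linear map `EuclideanSpace ℝ (Fin k) → EuclideanSpace ℝ (Fin m)`
given by multiplication by the matrix `M`. -/
noncomputable def matE {m k : ℕ} (M : Matrix (Fin m) (Fin k) ℝ) :
    EuclideanSpace ℝ (Fin k) →ₗ[ℝ] EuclideanSpace ℝ (Fin m) :=
  Matrix.toEuclideanLin M

/-- The Krylov subspace K_k(A, r) = span {r, A r, …, A^{k-1} r}. -/
noncomputable def Krylov {n : ℕ} (A : Matrix (Fin n) (Fin n) ℝ)
    (r : EuclideanSpace ℝ (Fin n)) (k : ℕ) :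
    Submodule ℝ (EuclideanSpace ℝ (Fin n)) :=
  Submodule.span ℝ {v | ∃ i < k, v = (matE A ^ i) r}

theorem pow_mem_Krylov {n : ℕ} (A : Matrix (Fin n) (Fin n) ℝ)
    (r : EuclideanSpace ℝ (Fin n)) {i k : ℕ} (h : i < k) :
    (matE A ^ i) r ∈ Krylov A r k :=
  subset_span ⟨i, h, rfl⟩

theorem Krylov_zero {n : ℕ} (A : Matrix (Fin n) (Fin n) ℝ)
    (r : EuclideanSpace ℝ (Fin n)) : Krylov A r 0 = ⊥ := by
  simp [Krylov]

theorem Krylov_mono {n : ℕ} (A : Matrix (Fin n) (Fin n) ℝ)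
    (r : EuclideanSpace ℝ (Fin n)) : Monotone (Krylov A r) := by
  intro j k h
  refine span_mono ?_
  rintro v ⟨i, hi, rfl⟩
  exact ⟨i, hi.trans_le h, rfl⟩

theorem finrank_Krylov_le {n : ℕ} (A : Matrix (Fin n) (Fin n) ℝ)
    (r : EuclideanSpace ℝ (Fin n)) (k : ℕ) : finrank ℝ (Krylov A r k) ≤ k := by
  classical
  have h : Krylov A r k = span ℝ
      (((Finset.range k).image fun i => (matE A ^ i) r : Finset _) : Set _) := by
    unfold Krylov
    congr 1
    ext v
    simp [eq_comm]
  rw [h]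
  exact (finrank_span_finset_le_card _).trans (Finset.card_image_le.trans (by simp))

/-- As long as each new power leaves the preceding Krylov subspace, the dimension is full. -/
theorem finrank_Krylov_eq {n : ℕ} (A : Matrix (Fin n) (Fin n) ℝ)
    (r : EuclideanSpace ℝ (Fin n)) (k : ℕ)
    (h : ∀ i < k, (matE A ^ i) r ∉ Krylov A r i) : finrank ℝ (Krylov A r k) = k := by
  refine le_antisymm (finrank_Krylov_le A r k) ?_
  induction k with
  | zero => exact Nat.zero_le _
  | succ k ih =>
    have hlt : Krylov A r k < Krylov A r (k + 1) :=
      lt_of_le_of_ne (Krylov_mono A r k.le_succ) fun he =>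
        h k k.lt_succ_self (he ▸ pow_mem_Krylov A r k.lt_succ_self)
    exact (ih fun i hi => h i (hi.trans k.lt_succ_self)).trans_lt (finrank_lt_finrank_of_lt hlt)

theorem exists_pow_mem_Krylov {n : ℕ} (A : Matrix (Fin n) (Fin n) ℝ)
    (r : EuclideanSpace ℝ (Fin n)) : ∃ k, (matE A ^ k) r ∈ Krylov A r k := by
  by_contra! h
  have h₁ := finrank_Krylov_eq A r (n + 1) fun i _ => h i
  have h₂ := finrank_le (Krylov A r (n + 1))
  rw [finrank_euclideanSpace_fin] at h₂
  omega

theorem Krylov_le_range {n : ℕ} (A : Matrix (Fin n) (Fin n) ℝ)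
    {r : EuclideanSpace ℝ (Fin n)} (hr : r ∈ LinearMap.range (matE A)) (k : ℕ) :
    Krylov A r k ≤ LinearMap.range (matE A) := by
  refine span_le.2 ?_
  rintro v ⟨i, -, rfl⟩
  cases i with
  | zero => simpa using hr
  | succ i => exact ⟨(matE A ^ i) r, by rw [pow_succ']; rfl⟩

/-- A Krylov subspace containing the next power is invariant. -/
theorem map_Krylov_le {n : ℕ} (A : Matrix (Fin n) (Fin n) ℝ)
    (r : EuclideanSpace ℝ (Fin n)) {k : ℕ} (h : (matE A ^ k) r ∈ Krylov A r k) :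
    (Krylov A r k).map (matE A) ≤ Krylov A r k := by
  refine map_le_iff_le_comap.2 (span_le.2 ?_)
  rintro v ⟨i, hi, rfl⟩
  change matE A ((matE A ^ i) r) ∈ Krylov A r k
  rw [← Module.End.mul_apply, ← pow_succ']
  rcases Nat.lt_or_ge (i + 1) k with hlt | hge
  · exact pow_mem_Krylov A r hlt
  · rwa [show i + 1 = k by omega]

/-- For a GP matrix (`N(A) ∩ R(A) = {0}`) and a consistent system (`b ∈ R(A)`), GMRES
does not break down: there is `m` with `1 ≤ m ≤ n` such that for all `1 ≤ j ≤ m` the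
Krylov subspace `K_j(A, r₀)` has dimension `j` and `A` is injective on it
(equivalently `dim A·K_j = dim K_j`), and `K_m(A, r₀)` contains an element `z` with
`A z = r₀`, this `z` being the unique element of `R(A)` with `A z = r₀`; hence
`x₀ + z` solves `A x = b`. -/
theorem gmres_converges_GP_consistent {n : ℕ} (A : Matrix (Fin n) (Fin n) ℝ)
    (hGP : LinearMap.ker (matE A) ⊓ LinearMap.range (matE A) = ⊥)
    (b x₀ r₀ : EuclideanSpace ℝ (Fin n))
    (hb : b ∈ LinearMap.range (matE A))
    (hr₀ : r₀ = b - matE A x₀)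
    (hr₀ne : r₀ ≠ 0) :
    ∃ m, 1 ≤ m ∧ m ≤ n ∧
      (∀ j, 1 ≤ j → j ≤ m →
        Module.finrank ℝ (Krylov A r₀ j) = j ∧
        (∀ z ∈ Krylov A r₀ j, matE A z = 0 → z = 0) ∧
        Module.finrank ℝ ((Krylov A r₀ j).map (matE A)) =
          Module.finrank ℝ (Krylov A r₀ j)) ∧
      ∃ z ∈ Krylov A r₀ m,
        matE A z = r₀ ∧
        z ∈ LinearMap.range (matE A) ∧
        (∀ w ∈ LinearMap.range (matE A), matE A w = r₀ → w = z) ∧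
        matE A (x₀ + z) = b := by
  classical
  have hr : r₀ ∈ LinearMap.range (matE A) := hr₀ ▸ sub_mem hb ⟨x₀, rfl⟩
  have hinj : ∀ z ∈ LinearMap.range (matE A), matE A z = 0 → z = 0 := fun z hz h => by
    have hmem : z ∈ LinearMap.ker (matE A) ⊓ LinearMap.range (matE A) := ⟨h, hz⟩
    rwa [hGP, mem_bot] at hmem
  have hfin : ∀ j, finrank ℝ ((Krylov A r₀ j).map (matE A)) = finrank ℝ (Krylov A r₀ j) := by
    intro j
    have hk : Function.Injective ((matE A).domRestrict (Krylov A r₀ j)) :=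
      (injective_iff_map_eq_zero _).2 fun z hz =>
        Subtype.ext (hinj z (Krylov_le_range A hr j z.2) hz)
    rw [← LinearMap.range_domRestrict]
    exact LinearMap.finrank_range_of_inj hk
  have hex := exists_pow_mem_Krylov A r₀
  have hm := Nat.find_spec hex
  have hmin : ∀ i < Nat.find hex, (matE A ^ i) r₀ ∉ Krylov A r₀ i := fun i => Nat.find_min hex
  generalize Nat.find hex = m at hm hmin
  have hm1 : 1 ≤ m := by
    refine Nat.one_le_iff_ne_zero.2 ?_
    rintro rfl
    rw [Krylov_zero] at hm
    exact hr₀ne (by simpa using hm)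
  refine ⟨m, hm1, ?_, fun j _ hj => ⟨finrank_Krylov_eq A r₀ j fun i hi => hmin i (hi.trans_le hj),
    fun z hz => hinj z (Krylov_le_range A hr j hz), hfin j⟩, ?_⟩
  · have h := finrank_le (Krylov A r₀ m)
    rwa [finrank_Krylov_eq A r₀ m hmin, finrank_euclideanSpace_fin] at h
  · have hmap : (Krylov A r₀ m).map (matE A) = Krylov A r₀ m :=
      eq_of_le_of_finrank_eq (map_Krylov_le A r₀ hm) (hfin m)
    have hr₀m : r₀ ∈ Krylov A r₀ m := by simpa using pow_mem_Krylov A r₀ hm1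
    rw [← hmap] at hr₀m
    obtain ⟨z, hz, hAz⟩ := hr₀m
    have hzr := Krylov_le_range A hr m hz
    refine ⟨z, hz, hAz, hzr, fun w hw hAw => sub_eq_zero.1 ?_, ?_⟩
    · exact hinj _ (sub_mem hw hzr) (by rw [map_sub, hAw, hAz, sub_self])
    · rw [map_add, hAz, hr₀, add_sub_cancel]
end

section
/- Let A be an n×n real matrix with R(Aᵀ) = R(A), let b ∈ ℝⁿ, x₀ ∈ ℝⁿ, and r₀ = b − A x₀. Then there exists m with 0 ≤ m ≤ n such that: (i) for every j with 1 ≤ j ≤ m, dim K_j(A, r₀) = j and N(A) ∩ K_j(A, r₀) = {0} (so GMRES does not break down through step m); and (ii) there exists z ∈ K_m(A, r₀) with ‖r₀ − A z‖ = min over all u ∈ ℝⁿ of ‖b − A u‖; hence x₀ + z is a least squares solution of min ‖b − A x‖. -/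
open Matrix Submodule Module

section KrylovSpan

/-- The Krylov subspace `span {r, T r, …, T ^ (k - 1) r}` of an endomorphism `T`. -/
def krylovSpan {K V : Type*} [Field K] [AddCommGroup V] [Module K V]
    (T : V →ₗ[K] V) (r : V) (k : ℕ) : Submodule K V :=
  Submodule.span K {v | ∃ i < k, v = (T ^ i) r}

variable {K V : Type*} [Field K] [AddCommGroup V] [Module K V] (T : V →ₗ[K] V) (r : V)

theorem krylovSpan_succ (k : ℕ) :
    krylovSpan T r (k + 1) = krylovSpan T r k ⊔ K ∙ (T ^ k) r := by
  rw [krylovSpan, krylovSpan, ← Submodule.span_union]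
  congr 1
  ext v
  simp only [Set.mem_ofPred_eq, Set.mem_union, Set.mem_singleton_iff, Order.lt_add_one_iff,
    le_iff_lt_or_eq]
  constructor
  · rintro ⟨i, hi | rfl, rfl⟩
    · exact Or.inl ⟨i, hi, rfl⟩
    · exact Or.inr rfl
  · rintro (⟨i, hi, rfl⟩ | rfl)
    · exact ⟨i, Or.inl hi, rfl⟩
    · exact ⟨k, Or.inr rfl, rfl⟩

theorem pow_apply_mem_krylovSpan {i k : ℕ} (h : i < k) : (T ^ i) r ∈ krylovSpan T r k :=
  Submodule.subset_span ⟨i, h, rfl⟩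

theorem map_krylovSpan_succ (k : ℕ) :
    (krylovSpan T r (k + 1)).map T = (krylovSpan T r k).map T ⊔ K ∙ (T ^ (k + 1)) r := by
  rw [krylovSpan_succ, Submodule.map_sup, Submodule.map_span, Set.image_singleton, pow_succ',
    Module.End.mul_apply]

variable [FiniteDimensional K V]

theorem finrank_krylovSpan_le (k : ℕ) : finrank K (krylovSpan T r k) ≤ k := by
  induction k with
  | zero =>
    have h : krylovSpan T r 0 = ⊥ :=
      Submodule.span_eq_bot.mpr fun _ ⟨i, hi, _⟩ => absurd hi i.not_lt_zero
    simp [h]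
  | succ k ih =>
    rw [krylovSpan_succ]
    have h₁ := Submodule.finrank_add_le_finrank_add_finrank (krylovSpan T r k) (K ∙ (T ^ k) r)
    have h₂ : finrank K (K ∙ (T ^ k) r) ≤ 1 := by
      simpa using finrank_span_le_card (R := K) ({(T ^ k) r} : Set V)
    lia

theorem le_finrank_map_krylovSpan {k : ℕ}
    (h : ∀ i < k, (T ^ (i + 1)) r ∉ (krylovSpan T r i).map T) :
    k ≤ finrank K ((krylovSpan T r k).map T) := by
  induction k with
  | zero => simp
  | succ k ih =>
    have hlt : (krylovSpan T r k).map T < (krylovSpan T r (k + 1)).map T := by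
      rw [map_krylovSpan_succ]
      refine lt_of_le_of_ne le_sup_left fun heq => h k k.lt_succ_self ?_
      rw [heq]
      exact Submodule.mem_sup_right (Submodule.mem_span_singleton_self _)
    have h₁ := Submodule.finrank_lt_finrank_of_lt hlt
    have h₂ := ih fun i hi => h i (hi.trans k.lt_succ_self)
    lia

/-- The index of the first linear dependence among `T r, T² r, …` is at most the dimension. -/
theorem exists_pow_succ_mem_map_krylovSpan :
    ∃ m ≤ finrank K V, (T ^ (m + 1)) r ∈ (krylovSpan T r m).map T ∧
      ∀ i < m, (T ^ (i + 1)) r ∉ (krylovSpan T r i).map T := by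
  classical
  have hex : ∃ m, (T ^ (m + 1)) r ∈ (krylovSpan T r m).map T := by
    by_contra! hne
    have h₁ := le_finrank_map_krylovSpan T r (k := finrank K V + 1) fun i _ => hne i
    have h₂ := Submodule.finrank_le ((krylovSpan T r (finrank K V + 1)).map T)
    lia
  exact ⟨Nat.find hex,
    (le_finrank_map_krylovSpan T r fun i hi => Nat.find_min hex hi).trans (Submodule.finrank_le _),
    Nat.find_spec hex, fun i hi => Nat.find_min hex hi⟩

theorem finrank_krylovSpan_and_ker_inf_eq_bot {k : ℕ}
    (h : k ≤ finrank K ((krylovSpan T r k).map T)) :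
    finrank K (krylovSpan T r k) = k ∧ LinearMap.ker T ⊓ krylovSpan T r k = ⊥ := by
  have hle := finrank_krylovSpan_le T r k
  have hsum := LinearMap.finrank_range_add_finrank_ker (T.domRestrict (krylovSpan T r k))
  rw [LinearMap.range_domRestrict] at hsum
  have hker : LinearMap.ker (T.domRestrict (krylovSpan T r k)) = ⊥ :=
    Submodule.finrank_eq_zero.mp (by lia)
  refine ⟨by lia, (Submodule.eq_bot_iff _).mpr ?_⟩
  rintro v ⟨hv, hvk⟩
  have : (⟨v, hvk⟩ : krylovSpan T r k) ∈ LinearMap.ker (T.domRestrict (krylovSpan T r k)) := hv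
  rw [hker] at this
  exact congrArg Subtype.val ((Submodule.mem_bot K).mp this)

/-- If `T` is injective on its range and `T ^ (m + 1) r` depends linearly on `T r, …, T ^ m r`,
then the component of `r` in the range of `T` lies in `T K_m`. -/
theorem mem_map_krylovSpan_of_pow_succ_mem
    (hdisj : Disjoint (LinearMap.range T) (LinearMap.ker T)) {m : ℕ}
    (hm : (T ^ (m + 1)) r ∈ (krylovSpan T r m).map T) {p : V} (hp : p ∈ LinearMap.range T)
    (hpr : T p = T r) : p ∈ (krylovSpan T r m).map T := by
  set S := (krylovSpan T r m).map T with hS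
  have hgen : ∀ i ≤ m, (T ^ (i + 1)) r ∈ S := by
    intro i hi
    rcases hi.lt_or_eq with hi | rfl
    · rw [pow_succ', Module.End.mul_apply]
      exact Submodule.mem_map_of_mem (pow_apply_mem_krylovSpan T r hi)
    · exact hm
  have hSr : S ≤ LinearMap.range T := LinearMap.map_le_range
  have hmap : S.map T ≤ S := by
    conv_lhs => rw [hS, krylovSpan]
    rw [Submodule.map_span, Submodule.map_span, Submodule.span_le]
    rintro _ ⟨_, ⟨_, ⟨i, hi, rfl⟩, rfl⟩, rfl⟩
    have := hgen (i + 1) hi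
    rwa [pow_succ', pow_succ', Module.End.mul_apply, Module.End.mul_apply] at this
  have heq : S.map T = S := by
    refine Submodule.eq_of_le_of_finrank_le hmap ?_
    have hsum := LinearMap.finrank_range_add_finrank_ker (T.domRestrict S)
    rw [LinearMap.range_domRestrict] at hsum
    have hker : LinearMap.ker (T.domRestrict S) = ⊥ := by
      refine (Submodule.eq_bot_iff _).mpr fun v hv => Subtype.ext ?_
      exact Submodule.disjoint_def.mp hdisj v (hSr v.2) hv
    rw [hker, finrank_bot] at hsum
    lia
  have hpS : T p ∈ S.map T := by
    rw [heq, hpr]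
    simpa using hgen 0 m.zero_le
  obtain ⟨s, hs, hsp⟩ := hpS
  have : p - s = 0 := Submodule.disjoint_def.mp hdisj _ (sub_mem hp (hSr hs))
    (by rw [LinearMap.mem_ker, map_sub, hsp, sub_self])
  rwa [sub_eq_zero.mp this]

end KrylovSpan

/-- A residual orthogonal to the range has minimal norm. -/
theorem norm_sub_le_norm_sub_of_mem_orthogonal_range {E : Type*} [NormedAddCommGroup E]
    [InnerProductSpace ℝ E] {T : E →ₗ[ℝ] E} {b x : E}
    (h : b - T x ∈ (LinearMap.range T)ᗮ) (u : E) : ‖b - T x‖ ≤ ‖b - T u‖ := by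
  have hu : b - T u = (b - T x) + T (x - u) := by rw [map_sub]; abel
  have h0 : inner ℝ (b - T x) (T (x - u)) = 0 :=
    Submodule.inner_left_of_mem_orthogonal (LinearMap.mem_range_self T _) h
  have := norm_add_sq_eq_norm_sq_add_norm_sq_of_inner_eq_zero _ _ h0
  rw [hu]
  nlinarith [norm_nonneg (b - T x), norm_nonneg (b - T x + T (x - u)),
    mul_self_nonneg ‖T (x - u)‖]

theorem orthogonal_range_matE_eq_ker {n : ℕ} {A : Matrix (Fin n) (Fin n) ℝ}
    (hEP : LinearMap.range (matE Aᵀ) = LinearMap.range (matE A)) :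
    (LinearMap.range (matE A))ᗮ = LinearMap.ker (matE A) := by
  have hadj : matE Aᵀ = (matE A).adjoint := by
    rw [matE, matE, ← Matrix.toEuclideanLin_conjTranspose_eq_adjoint,
      Matrix.conjTranspose_eq_transpose_of_trivial]
  rw [← hEP, hadj, LinearMap.orthogonal_range, LinearMap.adjoint_adjoint]

/-- For an EP (range-symmetric) matrix, `R(Aᵀ) = R(A)`, GMRES determines a least squares
solution of `min ‖b − A x‖` without breakdown: there is `m ≤ n` such that for all
`1 ≤ j ≤ m` the Krylov subspace `K_j(A, r₀)` has dimension `j` and meets `N(A)`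
trivially, and some `z ∈ K_m(A, r₀)` attains `‖r₀ − A z‖ = min_u ‖b − A u‖`;
hence `x₀ + z` is a least squares solution. -/
theorem gmres_converges_EP {n : ℕ} (A : Matrix (Fin n) (Fin n) ℝ)
    (hEP : LinearMap.range (matE Aᵀ) = LinearMap.range (matE A))
    (b x₀ r₀ : EuclideanSpace ℝ (Fin n))
    (hr₀ : r₀ = b - matE A x₀) :
    ∃ m, m ≤ n ∧
      (∀ j, 1 ≤ j → j ≤ m →
        Module.finrank ℝ (Krylov A r₀ j) = j ∧
        LinearMap.ker (matE A) ⊓ Krylov A r₀ j = ⊥) ∧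
      ∃ z ∈ Krylov A r₀ m,
        (‖r₀ - matE A z‖ = ⨅ u : EuclideanSpace ℝ (Fin n), ‖b - matE A u‖) ∧
        (∀ u : EuclideanSpace ℝ (Fin n), ‖b - matE A (x₀ + z)‖ ≤ ‖b - matE A u‖) := by
  have hker := orthogonal_range_matE_eq_ker hEP
  have hdisj : Disjoint (LinearMap.range (matE A)) (LinearMap.ker (matE A)) :=
    hker ▸ Submodule.orthogonal_disjoint _
  obtain ⟨m, hmn, hm, hmin⟩ := exists_pow_succ_mem_map_krylovSpan (matE A) r₀
  obtain ⟨p, hp, q, hq, hpq⟩ := (LinearMap.range (matE A)).exists_add_mem_mem_orthogonal r₀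
  have hpr : matE A p = matE A r₀ := by
    rw [hker] at hq
    rw [hpq, map_add, LinearMap.mem_ker.mp hq, add_zero]
  obtain ⟨z, hz, hzp⟩ := mem_map_krylovSpan_of_pow_succ_mem (matE A) r₀ hdisj hm hp hpr
  have hres : r₀ - matE A z = b - matE A (x₀ + z) := by
    rw [hr₀, map_add]
    abel
  have hbest := norm_sub_le_norm_sub_of_mem_orthogonal_range (T := matE A) (b := b) (x := x₀ + z)
    (by rwa [← hres, hpq, hzp, add_sub_cancel_left])
  refine ⟨m, by simpa using hmn, fun j _ hj => ?_, z, hz, ?_, hbest⟩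
  · exact finrank_krylovSpan_and_ker_inf_eq_bot (matE A) r₀
      (le_finrank_map_krylovSpan (matE A) r₀ fun i hi => hmin i (hi.trans_le hj))
  · rw [hres]
    exact le_antisymm (le_ciInf hbest)
      (ciInf_le ⟨0, Set.forall_mem_range.mpr fun _ => norm_nonneg _⟩ (x₀ + z))
end

section
/- Let A be an n×n real matrix, r₀ ∈ ℝⁿ, and suppose the Krylov subspace K = K_k(A, r₀) satisfies dim K = k, A·K ⊆ K (breakdown with K_{k+1}(A, r₀) = K_k(A, r₀)), and dim A·K = k. Then A·K = K, and there exists a unique z ∈ K with A z = r₀; in particular, for any x₀ with r₀ = b − A x₀, GMRES determines a solution x₀ + z of A x = b at step k (Case II of breakdown). -/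
open Matrix Submodule Module

/-- Case II of breakdown: if at step `k ≥ 1` the Krylov subspace `K = K_k(A, r₀)`
satisfies `dim K = k`, `A·K ⊆ K` and `dim A·K = k`, then `A·K = K`, there is a unique
`z ∈ K` with `A z = r₀`, and for any `b`, `x₀` with `r₀ = b − A x₀`, the iterate
`x₀ + z` solves `A x = b`. -/
theorem gmres_breakdown_caseII {n k : ℕ} (hk : 1 ≤ k)
    (A : Matrix (Fin n) (Fin n) ℝ) (r₀ : EuclideanSpace ℝ (Fin n))
    (hdim : Module.finrank ℝ (Krylov A r₀ k) = k)
    (hinv : (Krylov A r₀ k).map (matE A) ≤ Krylov A r₀ k)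
    (hdim' : Module.finrank ℝ ((Krylov A r₀ k).map (matE A)) = k) :
    (Krylov A r₀ k).map (matE A) = Krylov A r₀ k ∧
    (∃! z, z ∈ Krylov A r₀ k ∧ matE A z = r₀) ∧
    (∀ z ∈ Krylov A r₀ k, matE A z = r₀ →
      ∀ b x₀ : EuclideanSpace ℝ (Fin n), r₀ = b - matE A x₀ →
        matE A (x₀ + z) = b) := by
  have heq : (Krylov A r₀ k).map (matE A) = Krylov A r₀ k :=
    Submodule.eq_of_le_of_finrank_eq hinv (hdim'.trans hdim.symm)
  have hmem : r₀ ∈ Krylov A r₀ k := Submodule.subset_span ⟨0, hk, by simp⟩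
  have hmaps : ∀ x ∈ Krylov A r₀ k, matE A x ∈ Krylov A r₀ k :=
    fun x hx => hinv (Submodule.mem_map_of_mem hx)
  have hsurj : Function.Surjective ((matE A).restrict hmaps) := by
    rintro ⟨y, hy⟩
    rw [← heq] at hy
    obtain ⟨x, hx, hxy⟩ := hy
    exact ⟨⟨x, hx⟩, Subtype.ext hxy⟩
  have hinj := LinearMap.injective_iff_surjective.mpr hsurj
  refine ⟨heq, ?_, ?_⟩
  · obtain ⟨z, hz⟩ := hsurj ⟨r₀, hmem⟩
    refine ⟨z, ⟨z.2, congrArg Subtype.val hz⟩, ?_⟩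
    rintro y ⟨hy, hyr⟩
    have hyz : (⟨y, hy⟩ : Krylov A r₀ k) = z := hinj ((Subtype.ext hyr).trans hz.symm)
    exact congrArg Subtype.val hyz
  · intro z _ hz b x₀ hr
    rw [map_add, hz, hr, add_sub_cancel]
end

section
/- Let A be an n×n real matrix, b ∈ ℝⁿ, x₀ ∈ ℝⁿ, and r₀ = b − A x₀. If the range-restricted Krylov subspace K_m(A, A r₀) satisfies dim A·K_m(A, A r₀) = rank(A), then A·K_m(A, A r₀) = R(A), and consequently min over z ∈ K_m(A, A r₀) of ‖b − A(x₀ + z)‖ equals min over all u ∈ ℝⁿ of ‖b − A u‖; that is, RR-GMRES determines a least squares solution of min ‖b − A x‖ at step m. -/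
open Matrix Submodule Module

/-- If the range-restricted Krylov subspace `K_m(A, A r₀)` satisfies
`dim A·K_m(A, A r₀) = rank A`, then `A·K_m(A, A r₀) = R(A)` and the minimum of
`‖b − A(x₀ + z)‖` over `z ∈ K_m(A, A r₀)` equals the minimum of `‖b − A u‖` over all
`u`; i.e. RR-GMRES determines a least squares solution at step `m`. -/
theorem rrgmres_least_squares {n m : ℕ} (A : Matrix (Fin n) (Fin n) ℝ)
    (b x₀ r₀ : EuclideanSpace ℝ (Fin n))
    (hr₀ : r₀ = b - matE A x₀)
    (hdim : Module.finrank ℝ ((Krylov A (matE A r₀) m).map (matE A)) =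
      Module.finrank ℝ (LinearMap.range (matE A))) :
    (Krylov A (matE A r₀) m).map (matE A) = LinearMap.range (matE A) ∧
    (⨅ z : (Krylov A (matE A r₀) m), ‖b - matE A (x₀ + (z : EuclideanSpace ℝ (Fin n)))‖) =
      ⨅ u : EuclideanSpace ℝ (Fin n), ‖b - matE A u‖ := by
  have hrange : (Krylov A (matE A r₀) m).map (matE A) = LinearMap.range (matE A) :=
    Submodule.eq_of_le_of_finrank_eq LinearMap.map_le_range hdim
  refine ⟨hrange, congrArg sInf (Set.Subset.antisymm ?_ ?_)⟩
  · rintro _ ⟨z, rfl⟩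
    exact ⟨x₀ + z, rfl⟩
  · rintro _ ⟨u, rfl⟩
    have hu : matE A (u - x₀) ∈ (Krylov A (matE A r₀) m).map (matE A) :=
      hrange ▸ LinearMap.mem_range_self _ _
    obtain ⟨z, hz, hzu⟩ := hu
    refine ⟨⟨z, hz⟩, ?_⟩
    simp only [map_add, hzu, map_sub, add_sub_cancel]
end

section
/- Let A be an n×n real matrix of rank r, and let U₁, V₁ be n×r real matrices with orthonormal columns (U₁ᵀU₁ = V₁ᵀV₁ = I_r) whose column spaces are R(A) and R(Aᵀ), respectively. Then N(A) ∩ R(A) = {0} if and only if the r×r matrix V₁ᵀU₁ is invertible. -/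
open Matrix Submodule Module

theorem matE_mul {m k l : ℕ} (M : Matrix (Fin m) (Fin k) ℝ) (N : Matrix (Fin k) (Fin l) ℝ) :
    matE (M * N) = matE M ∘ₗ matE N :=
  Matrix.toLpLin_mul_same 2 M N

theorem ker_matE_eq_bot_iff_isUnit {r : ℕ} (M : Matrix (Fin r) (Fin r) ℝ) :
    LinearMap.ker (matE M) = ⊥ ↔ IsUnit M := by
  rw [← Matrix.mulVec_injective_iff_isUnit, LinearMap.ker_eq_bot]
  have h : ⇑(matE M) = WithLp.toLp 2 ∘ M.mulVec ∘ WithLp.ofLp := by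
    ext x : 1
    simp [matE, Matrix.toLpLin_apply]
  rw [h, (WithLp.toLp_injective 2).of_comp_iff,
    Function.Injective.of_comp_iff' _ (WithLp.ofLp_bijective 2)]

theorem ker_matE_eq_orthogonal_range_transpose {m k : ℕ} (M : Matrix (Fin m) (Fin k) ℝ) :
    LinearMap.ker (matE M) = (LinearMap.range (matE Mᵀ))ᗮ := by
  have h : matE Mᵀ = LinearMap.adjoint (matE M) := by
    rw [← Matrix.conjTranspose_eq_transpose_of_trivial]
    exact Matrix.toEuclideanLin_conjTranspose_eq_adjoint M
  rw [h, LinearMap.orthogonal_range, LinearMap.adjoint_adjoint]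

/-- Let `A` be `n×n` of rank `r`, and `U₁`, `V₁` be `n×r` matrices with orthonormal
columns spanning `R(A)` and `R(Aᵀ)` respectively. Then `N(A) ∩ R(A) = {0}` (i.e. `A`
is a GP matrix) if and only if the `r×r` matrix `V₁ᵀU₁` is invertible. -/
theorem gp_iff_V1tU1_invertible {n r : ℕ} (A : Matrix (Fin n) (Fin n) ℝ)
    (hrank : Module.finrank ℝ (LinearMap.range (matE A)) = r)
    (U₁ V₁ : Matrix (Fin n) (Fin r) ℝ)
    (hU : U₁ᵀ * U₁ = 1) (hV : V₁ᵀ * V₁ = 1)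
    (hUrange : LinearMap.range (matE U₁) = LinearMap.range (matE A))
    (hVrange : LinearMap.range (matE V₁) = LinearMap.range (matE Aᵀ)) :
    LinearMap.ker (matE A) ⊓ LinearMap.range (matE A) = ⊥ ↔ IsUnit (V₁ᵀ * U₁) := by
  have hker : LinearMap.ker (matE A) = LinearMap.ker (matE V₁ᵀ) := by
    rw [ker_matE_eq_orthogonal_range_transpose, ker_matE_eq_orthogonal_range_transpose,
      Matrix.transpose_transpose, hVrange]
  have hinj : LinearMap.ker (matE U₁) = ⊥ := by
    have h : matE U₁ᵀ ∘ₗ matE U₁ = LinearMap.id := by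
      rw [← matE_mul, hU]
      simp [matE]
    exact LinearMap.ker_eq_bot_of_inverse h
  rw [← ker_matE_eq_bot_iff_isUnit, matE_mul, LinearMap.ker_comp, hker, ← hUrange, inf_comm,
    ← Submodule.map_comap_eq]
  rw [← Submodule.map_bot (matE U₁)]
  exact (Submodule.map_injective_of_injective (LinearMap.ker_eq_bot.mp hinj)).eq_iff
end

section
/- Let A be a nonzero n×n real matrix of rank r, and let U₁, V₁ be n×r real matrices with orthonormal columns (U₁ᵀU₁ = V₁ᵀV₁ = I_r) whose column spaces are R(A) and R(Aᵀ), respectively. Then R(Aᵀ) = R(A) if and only if V₁ᵀU₁ is an orthogonal matrix, i.e. (V₁ᵀU₁)ᵀ(V₁ᵀU₁) = I_r. -/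
open Matrix Submodule Module

/-- The range of `matE M` lies in that of `matE N` exactly when `M` is a right multiple of `N`. -/
theorem range_matE_le_iff {m k l : ℕ} (M : Matrix (Fin m) (Fin k) ℝ)
    (N : Matrix (Fin m) (Fin l) ℝ) :
    LinearMap.range (matE M) ≤ LinearMap.range (matE N) ↔
      ∃ C : Matrix (Fin l) (Fin k) ℝ, M = N * C := by
  constructor
  · intro h
    have hcol : ∀ j, ∃ c : Fin l → ℝ, N *ᵥ c = M.col j := by
      intro j
      obtain ⟨y, hy⟩ := h ⟨EuclideanSpace.single j 1, rfl⟩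
      refine ⟨y.ofLp, ?_⟩
      have := congrArg WithLp.ofLp hy
      simpa [matE, Matrix.toLpLin_apply] using this
    choose c hc using hcol
    refine ⟨Matrix.of fun i j => c j i, ?_⟩
    ext i j
    exact (congrFun (hc j) i).symm
  · rintro ⟨C, rfl⟩ _ ⟨x, rfl⟩
    exact ⟨matE C x, by simp [matE, Matrix.toLpLin_apply, Matrix.mulVec_mulVec]⟩

/-- Two matrices of the same size with orthonormal columns have the same column space
if and only if `Vᵀ * U` is orthogonal. -/
theorem range_matE_eq_iff_of_orthonormal {n r : ℕ} (U V : Matrix (Fin n) (Fin r) ℝ)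
    (hU : Uᵀ * U = 1) (hV : Vᵀ * V = 1) :
    LinearMap.range (matE V) = LinearMap.range (matE U) ↔ (Vᵀ * U)ᵀ * (Vᵀ * U) = 1 := by
  constructor
  · intro h
    obtain ⟨C, rfl⟩ := (range_matE_le_iff U V).1 h.ge
    rw [← Matrix.mul_assoc Vᵀ, hV, Matrix.one_mul]
    rwa [Matrix.transpose_mul, Matrix.mul_assoc, ← Matrix.mul_assoc Vᵀ, hV,
      Matrix.one_mul] at hU
  · intro h
    obtain ⟨W, hW⟩ : ∃ W, W = Vᵀ * U := ⟨_, rfl⟩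
    rw [← hW] at h
    have hWt : Uᵀ * V = Wᵀ := by rw [hW, Matrix.transpose_mul, Matrix.transpose_transpose]
    have hE : (U - V * W)ᵀ * (U - V * W) = 0 := by
      rw [Matrix.transpose_sub, Matrix.transpose_mul, Matrix.sub_mul, Matrix.mul_sub,
        Matrix.mul_sub, hU, ← Matrix.mul_assoc Uᵀ, hWt, Matrix.mul_assoc Wᵀ Vᵀ U, ← hW,
        Matrix.mul_assoc Wᵀ Vᵀ, ← Matrix.mul_assoc Vᵀ V, hV, Matrix.one_mul, h]
      simp
    have hUV : U = V * W := by
      rw [← Matrix.conjTranspose_eq_transpose_of_trivial,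
        Matrix.conjTranspose_mul_self_eq_zero] at hE
      exact sub_eq_zero.1 hE
    have hVU : V = U * Wᵀ := by
      rw [hUV, Matrix.mul_assoc, mul_eq_one_comm.1 h, Matrix.mul_one]
    exact le_antisymm ((range_matE_le_iff V U).2 ⟨_, hVU⟩) ((range_matE_le_iff U V).2 ⟨_, hUV⟩)

/-- Let `A` be a nonzero `n×n` matrix of rank `r`, and `U₁`, `V₁` be `n×r` matrices with
orthonormal columns spanning `R(A)` and `R(Aᵀ)` respectively. Then `A` is EP
(`R(Aᵀ) = R(A)`) if and only if `V₁ᵀU₁` is an orthogonal matrix. -/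
theorem ep_iff_V1tU1_orthogonal {n r : ℕ} (A : Matrix (Fin n) (Fin n) ℝ)
    (hA : A ≠ 0)
    (hrank : Module.finrank ℝ (LinearMap.range (matE A)) = r)
    (U₁ V₁ : Matrix (Fin n) (Fin r) ℝ)
    (hU : U₁ᵀ * U₁ = 1) (hV : V₁ᵀ * V₁ = 1)
    (hUrange : LinearMap.range (matE U₁) = LinearMap.range (matE A))
    (hVrange : LinearMap.range (matE V₁) = LinearMap.range (matE Aᵀ)) :
    LinearMap.range (matE Aᵀ) = LinearMap.range (matE A) ↔
      (V₁ᵀ * U₁)ᵀ * (V₁ᵀ * U₁) = 1 := by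
  rw [← hUrange, ← hVrange]
  exact range_matE_eq_iff_of_orthonormal U₁ V₁ hU hV
end

section
/- Let A be an n×n real matrix with R(Aᵀ) = R(A), let b ∈ R(A), x₀ ∈ ℝⁿ, and r₀ = b − A x₀. Then for every k ≥ 1, K_k(A, r₀) ⊆ R(A), and hence inf over nonzero z ∈ K_k(A, r₀) of ‖A z‖/‖z‖ ≥ inf over nonzero z ∈ N(A)^⊥ of ‖A z‖/‖z‖ > 0 (assuming A ≠ 0); consequently the condition number of the restriction of A to K_k(A, r₀) (equal to the condition number of the Arnoldi Hessenberg matrix H_{k+1,k}) is at most κ(A) = ‖A‖ / (inf over nonzero z ∈ N(A)^⊥ of ‖A z‖/‖z‖). -/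
open Matrix Submodule Module

/-- `opN M` : the spectral norm (operator 2-norm) of the matrix `M`. -/
noncomputable def opN {m k : ℕ} (M : Matrix (Fin m) (Fin k) ℝ) : ℝ :=
  ‖LinearMap.toContinuousLinearMap (matE M)‖

/-- `supRatio M S` : the supremum of `‖M z‖ / ‖z‖` over nonzero `z ∈ S`. -/
noncomputable def supRatio {a b : ℕ} (M : Matrix (Fin a) (Fin b) ℝ)
    (S : Set (EuclideanSpace ℝ (Fin b))) : ℝ :=
  sSup ((fun z => ‖matE M z‖ / ‖z‖) '' {z ∈ S | z ≠ 0})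

/-- `infRatio M S` : the infimum of `‖M z‖ / ‖z‖` over nonzero `z ∈ S`. -/
noncomputable def infRatio {a b : ℕ} (M : Matrix (Fin a) (Fin b) ℝ)
    (S : Set (EuclideanSpace ℝ (Fin b))) : ℝ :=
  sInf ((fun z => ‖matE M z‖ / ‖z‖) '' {z ∈ S | z ≠ 0})

theorem range_matE_transpose_le_orthogonal_ker {m k : ℕ} (M : Matrix (Fin m) (Fin k) ℝ) :
    LinearMap.range (matE Mᵀ) ≤ (LinearMap.ker (matE M))ᗮ := by
  rintro _ ⟨y, rfl⟩
  rw [Submodule.mem_orthogonal]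
  intro z hz
  have hadj : matE Mᵀ = LinearMap.adjoint (matE M) := by
    rw [matE, matE, ← Matrix.toEuclideanLin_conjTranspose_eq_adjoint,
      Matrix.conjTranspose_eq_transpose_of_trivial]
  rw [hadj, LinearMap.adjoint_inner_right, LinearMap.mem_ker.mp hz, inner_zero_left]

theorem krylov_le_of_mem {n : ℕ} {A : Matrix (Fin n) (Fin n) ℝ}
    {r : EuclideanSpace ℝ (Fin n)} (hr : r ∈ LinearMap.range (matE A)) (k : ℕ) :
    Krylov A r k ≤ LinearMap.range (matE A) := by
  refine Submodule.span_le.mpr ?_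
  rintro _ ⟨i, -, rfl⟩
  cases i with
  | zero => simpa using hr
  | succ i => exact ⟨(matE A ^ i) r, by rw [pow_succ', Module.End.mul_apply]⟩

theorem mem_krylov_self {n : ℕ} (A : Matrix (Fin n) (Fin n) ℝ)
    (r : EuclideanSpace ℝ (Fin n)) {k : ℕ} (hk : 1 ≤ k) : r ∈ Krylov A r k :=
  Submodule.subset_span ⟨0, hk, by simp⟩

theorem bddBelow_ratio {a b : ℕ} (M : Matrix (Fin a) (Fin b) ℝ)
    (S : Set (EuclideanSpace ℝ (Fin b))) :
    BddBelow ((fun z => ‖matE M z‖ / ‖z‖) '' {z ∈ S | z ≠ 0}) := by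
  refine ⟨0, ?_⟩
  rintro _ ⟨z, -, rfl⟩
  positivity

theorem infRatio_anti {a b : ℕ} (M : Matrix (Fin a) (Fin b) ℝ)
    {S T : Set (EuclideanSpace ℝ (Fin b))} (hST : S ⊆ T) (hS : ∃ z ∈ S, z ≠ 0) :
    infRatio M T ≤ infRatio M S := by
  obtain ⟨z, hz, hz0⟩ := hS
  exact csInf_le_csInf (bddBelow_ratio M T) ⟨_, z, ⟨hz, hz0⟩, rfl⟩
    (Set.image_mono fun w hw => ⟨hST hw.1, hw.2⟩)

theorem supRatio_le_opN {a b : ℕ} (M : Matrix (Fin a) (Fin b) ℝ)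
    (S : Set (EuclideanSpace ℝ (Fin b))) : supRatio M S ≤ opN M := by
  refine Real.sSup_le ?_ (norm_nonneg _)
  rintro _ ⟨z, -, rfl⟩
  exact (LinearMap.toContinuousLinearMap (matE M)).ratio_le_opNorm z

theorem infRatio_orthogonal_ker_pos {a b : ℕ} (M : Matrix (Fin a) (Fin b) ℝ)
    (hne : ∃ z ∈ (LinearMap.ker (matE M))ᗮ, z ≠ 0) :
    0 < infRatio M ((LinearMap.ker (matE M))ᗮ : Set _) := by
  obtain ⟨w, hw, hw0⟩ := hne
  have hker : LinearMap.ker ((matE M).domRestrict (LinearMap.ker (matE M))ᗮ) = ⊥ := by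
    rw [LinearMap.ker_eq_bot']
    rintro ⟨z, hz⟩ h
    exact Subtype.ext (Submodule.disjoint_def.mp
      (Submodule.orthogonal_disjoint (LinearMap.ker (matE M))) z h hz)
  obtain ⟨K, hK, hanti⟩ := LinearMap.exists_antilipschitzWith _ hker
  refine lt_of_lt_of_le (inv_pos.mpr (NNReal.coe_pos.mpr hK))
    (le_csInf ⟨_, w, ⟨hw, hw0⟩, rfl⟩ ?_)
  rintro _ ⟨z, ⟨hz, hz0⟩, rfl⟩
  have hbound : ‖z‖ ≤ K * ‖matE M z‖ := by
    simpa using hanti.le_mul_dist ⟨z, hz⟩ 0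
  have hzpos : 0 < ‖z‖ := norm_pos_iff.mpr hz0
  have hKpos : (0 : ℝ) < K := NNReal.coe_pos.mpr hK
  rw [le_div_iff₀ hzpos, inv_mul_le_iff₀ hKpos]
  exact hbound

/-- In the consistent EP case (`R(Aᵀ) = R(A)`, `b ∈ R(A)`), for every `k ≥ 1` the
Krylov subspace `K_k(A, r₀)` lies in `R(A)`, the infimum of `‖A z‖/‖z‖` over nonzero
`z ∈ K_k(A, r₀)` is bounded below by the (positive) smallest nonzero singular value of
`A`, and the condition number of the restriction of `A` to `K_k(A, r₀)` (equal to the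
condition number of the Arnoldi Hessenberg matrix `H_{k+1,k}`) is at most
`κ(A) = ‖A‖ / inf_{0 ≠ z ∈ N(A)^⊥} (‖A z‖/‖z‖)`. -/
theorem ep_consistent_hessenberg_bound {n : ℕ} (A : Matrix (Fin n) (Fin n) ℝ)
    (hA : A ≠ 0)
    (hEP : LinearMap.range (matE Aᵀ) = LinearMap.range (matE A))
    (b x₀ r₀ : EuclideanSpace ℝ (Fin n))
    (hb : b ∈ LinearMap.range (matE A))
    (hr₀ : r₀ = b - matE A x₀)
    (hr₀ne : r₀ ≠ 0) :
    ∀ k, 1 ≤ k →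
      Krylov A r₀ k ≤ LinearMap.range (matE A) ∧
      infRatio A ((LinearMap.ker (matE A))ᗮ : Set _) ≤
        infRatio A (Krylov A r₀ k : Set _) ∧
      0 < infRatio A ((LinearMap.ker (matE A))ᗮ : Set _) ∧
      supRatio A (Krylov A r₀ k : Set _) / infRatio A (Krylov A r₀ k : Set _) ≤
        opN A / infRatio A ((LinearMap.ker (matE A))ᗮ : Set _) := by
  intro k hk
  have hr : r₀ ∈ LinearMap.range (matE A) :=
    hr₀ ▸ Submodule.sub_mem _ hb (LinearMap.mem_range_self _ x₀)
  have hKrange := krylov_le_of_mem hr k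
  have hKorth : Krylov A r₀ k ≤ (LinearMap.ker (matE A))ᗮ :=
    hKrange.trans (hEP ▸ range_matE_transpose_le_orthogonal_ker A)
  have hrK := mem_krylov_self A r₀ hk
  have hinf := infRatio_anti A (SetLike.coe_subset_coe.mpr hKorth) ⟨r₀, hrK, hr₀ne⟩
  have hpos := infRatio_orthogonal_ker_pos A ⟨r₀, hKorth hrK, hr₀ne⟩
  exact ⟨hKrange, hinf, hpos,
    div_le_div₀ (norm_nonneg _) (supRatio_le_opN A _) hpos hinf⟩
end

section
/- Let A be an n×n real matrix of rank r with N(A) ∩ R(A) = {0}, and let b ∈ R(A). Then there exists a unique x♯ ∈ R(A) with A x♯ = b and a unique x⁎ ∈ N(A)^⊥ with A x⁎ = b, and x⁎ equals the orthogonal projection of x♯ onto N(A)^⊥ = R(Aᵀ). Moreover, if U₁, V₁ are n×r matrices with orthonormal columns whose column spaces are R(A) and R(Aᵀ), respectively, then σ·‖x♯‖ ≤ ‖x⁎‖ ≤ ‖x♯‖, where σ = inf over nonzero w ∈ ℝʳ of ‖V₁ᵀU₁ w‖/‖w‖ (the smallest singular value of V₁ᵀU₁). -/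
open Matrix Submodule Module

theorem matE_mul_apply {l m k : ℕ} (M : Matrix (Fin l) (Fin m) ℝ) (N : Matrix (Fin m) (Fin k) ℝ)
    (x : EuclideanSpace ℝ (Fin k)) : matE (M * N) x = matE M (matE N x) := by
  simp [matE, Matrix.toLpLin_apply, Matrix.mulVec_mulVec]

theorem inner_matE_left {m k : ℕ} (M : Matrix (Fin m) (Fin k) ℝ)
    (x : EuclideanSpace ℝ (Fin k)) (y : EuclideanSpace ℝ (Fin m)) :
    inner ℝ (matE M x) y = inner ℝ x (matE Mᵀ y) := by
  rw [matE, matE, ← Matrix.conjTranspose_eq_transpose_of_trivial,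
    Matrix.toEuclideanLin_conjTranspose_eq_adjoint, LinearMap.adjoint_inner_right]

theorem norm_matE_of_transpose_mul_self {m k : ℕ} {M : Matrix (Fin m) (Fin k) ℝ}
    (hM : Mᵀ * M = 1) (x : EuclideanSpace ℝ (Fin k)) : ‖matE M x‖ = ‖x‖ := by
  have h : ‖matE M x‖ ^ 2 = ‖x‖ ^ 2 := by
    rw [← real_inner_self_eq_norm_sq, ← real_inner_self_eq_norm_sq, inner_matE_left,
      ← matE_mul_apply, hM]
    simp [matE]
  exact (sq_eq_sq₀ (norm_nonneg _) (norm_nonneg _)).mp h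

theorem norm_matE_transpose_le {m k : ℕ} {M : Matrix (Fin m) (Fin k) ℝ}
    (hM : Mᵀ * M = 1) (y : EuclideanSpace ℝ (Fin m)) : ‖matE Mᵀ y‖ ≤ ‖y‖ := by
  have h : ‖matE Mᵀ y‖ * ‖matE Mᵀ y‖ ≤ ‖matE Mᵀ y‖ * ‖y‖ := by
    rw [← real_inner_self_eq_norm_mul_norm, ← inner_matE_left]
    simpa only [norm_matE_of_transpose_mul_self hM] using
      real_inner_le_norm (matE M (matE Mᵀ y)) y
  rcases (norm_nonneg (matE Mᵀ y)).eq_or_lt with h0 | h0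
  · rw [← h0]
    exact norm_nonneg y
  · exact le_of_mul_le_mul_left h h0

theorem matE_transpose_eq_zero_of_range_eq {n r : ℕ} {A : Matrix (Fin n) (Fin n) ℝ}
    {V : Matrix (Fin n) (Fin r) ℝ}
    (hV : LinearMap.range (matE V) = LinearMap.range (matE Aᵀ))
    {k : EuclideanSpace ℝ (Fin n)} (hk : matE A k = 0) : matE Vᵀ k = 0 := by
  refine ext_inner_left ℝ fun z => ?_
  obtain ⟨u, hu⟩ : matE V z ∈ LinearMap.range (matE Aᵀ) := hV ▸ LinearMap.mem_range_self _ z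
  rw [← inner_matE_left, ← hu, inner_matE_left, Matrix.transpose_transpose, hk]
  simp

theorem infRatio_univ_mul_norm_le {a b : ℕ} (M : Matrix (Fin a) (Fin b) ℝ)
    (w : EuclideanSpace ℝ (Fin b)) : infRatio M Set.univ * ‖w‖ ≤ ‖matE M w‖ := by
  rcases eq_or_ne w 0 with rfl | hw
  · simp
  · rw [← le_div_iff₀ (norm_pos_iff.mpr hw)]
    refine csInf_le ⟨0, ?_⟩ ⟨w, ⟨Set.mem_univ w, hw⟩, rfl⟩
    rintro _ ⟨z, -, rfl⟩
    positivity

/-- An endomorphism whose kernel meets its range trivially attains every value of its range on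
its range. -/
theorem LinearMap.exists_mem_range_apply_eq_of_ker_inf_range_eq_bot {K E : Type*}
    [DivisionRing K] [AddCommGroup E] [Module K E] [FiniteDimensional K E] {T : E →ₗ[K] E}
    (hT : LinearMap.ker T ⊓ LinearMap.range T = ⊥) {b : E} (hb : b ∈ LinearMap.range T) :
    ∃ x ∈ LinearMap.range T, T x = b := by
  obtain ⟨y, rfl⟩ := hb
  have hfin := T.finrank_range_add_finrank_ker
  have htop : LinearMap.ker T ⊔ LinearMap.range T = ⊤ :=
    Submodule.eq_top_of_disjoint _ _ (by omega) (disjoint_iff.mpr hT)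
  obtain ⟨k, hk, x, hx, rfl⟩ := Submodule.mem_sup.mp (htop ▸ Submodule.mem_top : y ∈ _)
  exact ⟨x, hx, by rw [map_add, LinearMap.mem_ker.mp hk, zero_add]⟩

/-- For a GP matrix `A` of rank `r` and `b ∈ R(A)`: there is a unique solution
`x♯ ∈ R(A)` (the group-inverse solution) and a unique solution `x⁎ ∈ N(A)^⊥` (the
pseudoinverse solution) of `A x = b`; `x⁎` is the orthogonal projection of `x♯` onto
`N(A)^⊥ = R(Aᵀ)`; and `σ·‖x♯‖ ≤ ‖x⁎‖ ≤ ‖x♯‖`, with `σ` the smallest singular value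
of `V₁ᵀU₁` where `U₁`, `V₁` have orthonormal columns spanning `R(A)`, `R(Aᵀ)`. -/
theorem group_vs_pseudoinverse_solution {n r : ℕ} (A : Matrix (Fin n) (Fin n) ℝ)
    (hrank : Module.finrank ℝ (LinearMap.range (matE A)) = r)
    (hGP : LinearMap.ker (matE A) ⊓ LinearMap.range (matE A) = ⊥)
    (U₁ V₁ : Matrix (Fin n) (Fin r) ℝ)
    (hU : U₁ᵀ * U₁ = 1) (hV : V₁ᵀ * V₁ = 1)
    (hUrange : LinearMap.range (matE U₁) = LinearMap.range (matE A))
    (hVrange : LinearMap.range (matE V₁) = LinearMap.range (matE Aᵀ))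
    (b : EuclideanSpace ℝ (Fin n)) (hb : b ∈ LinearMap.range (matE A)) :
    ∃ xsharp xstar : EuclideanSpace ℝ (Fin n),
      xsharp ∈ LinearMap.range (matE A) ∧ matE A xsharp = b ∧
      (∀ y ∈ LinearMap.range (matE A), matE A y = b → y = xsharp) ∧
      xstar ∈ (LinearMap.ker (matE A))ᗮ ∧ matE A xstar = b ∧
      (∀ y ∈ (LinearMap.ker (matE A))ᗮ, matE A y = b → y = xstar) ∧
      xstar = (orthogonalProjection ((LinearMap.ker (matE A))ᗮ) xsharp :
        EuclideanSpace ℝ (Fin n)) ∧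
      infRatio (V₁ᵀ * U₁) Set.univ * ‖xsharp‖ ≤ ‖xstar‖ ∧
      ‖xstar‖ ≤ ‖xsharp‖ := by
  have hunique {S : Submodule ℝ (EuclideanSpace ℝ (Fin n))}
      (hS : LinearMap.ker (matE A) ⊓ S = ⊥) {x y : EuclideanSpace ℝ (Fin n)}
      (hx : x ∈ S) (hy : y ∈ S) (hxy : matE A y = matE A x) : y = x := by
    have h : y - x ∈ LinearMap.ker (matE A) ⊓ S :=
      ⟨LinearMap.mem_ker.mpr (by rw [map_sub, hxy, sub_self]), S.sub_mem hy hx⟩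
    rw [hS, Submodule.mem_bot] at h
    exact sub_eq_zero.mp h
  obtain ⟨x, hxR, hxb⟩ := LinearMap.exists_mem_range_apply_eq_of_ker_inf_range_eq_bot hGP hb
  set p := ((LinearMap.ker (matE A))ᗮ).starProjection x
  have hpK : p ∈ (LinearMap.ker (matE A))ᗮ := Submodule.starProjection_apply_mem _ x
  have hker : matE A (x - p) = 0 := by
    have h : x - p ∈ (LinearMap.ker (matE A))ᗮᗮ := Submodule.sub_starProjection_mem_orthogonal x
    rwa [Submodule.orthogonal_orthogonal, LinearMap.mem_ker] at h
  have hpb : matE A p = b := by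
    rw [map_sub, sub_eq_zero] at hker
    rw [← hker, hxb]
  refine ⟨x, p, hxR, hxb, fun y hy hyb => hunique hGP hxR hy (hyb.trans hxb.symm), hpK, hpb,
    fun y hy hyb => hunique (Submodule.inf_orthogonal_eq_bot _) hpK hy (hyb.trans hpb.symm),
    rfl, ?_, Submodule.norm_starProjection_apply_le _ x⟩
  obtain ⟨w, rfl⟩ : x ∈ LinearMap.range (matE U₁) := hUrange ▸ hxR
  have hV₁ : matE V₁ᵀ (matE U₁ w) = matE V₁ᵀ p := by
    rw [← sub_eq_zero, ← map_sub, matE_transpose_eq_zero_of_range_eq hVrange hker]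
  calc infRatio (V₁ᵀ * U₁) Set.univ * ‖matE U₁ w‖
      = infRatio (V₁ᵀ * U₁) Set.univ * ‖w‖ := by rw [norm_matE_of_transpose_mul_self hU]
    _ ≤ ‖matE (V₁ᵀ * U₁) w‖ := infRatio_univ_mul_norm_le _ w
    _ = ‖matE V₁ᵀ p‖ := by rw [matE_mul_apply, hV₁]
    _ ≤ ‖p‖ := norm_matE_transpose_le hV p
end

section
/- Let A be an n×n real matrix of rank r, and let U₁, V₁ be n×r real matrices with orthonormal columns whose column spaces are R(A) and R(Aᵀ), respectively. Then: (i) for every nonzero z ∈ R(A), ‖A z‖/‖z‖ ≥ σ_min · (inf over nonzero w ∈ N(A)^⊥ of ‖A w‖/‖w‖), where σ_min = inf over nonzero w ∈ ℝʳ of ‖V₁ᵀU₁ w‖/‖w‖; and (ii) sup over nonzero z ∈ R(A) of ‖A z‖/‖z‖ ≤ ‖A‖·‖V₁ᵀU₁‖. Consequently, if N(A) ∩ R(A) = {0} and σ_min > 0, the condition number of the restriction of A to R(A) (and hence of the Arnoldi Hessenberg matrix H_{k+1,k} in the consistent case, where K_k(A, r₀) ⊆ R(A)) is at most κ(A)·κ(V₁ᵀU₁).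 -/
open Matrix Submodule Module

section Ratios

variable {a b : ℕ} (M : Matrix (Fin a) (Fin b) ℝ)

lemma infRatio_mul_norm_le {S : Set (EuclideanSpace ℝ (Fin b))} {z : EuclideanSpace ℝ (Fin b)}
    (hz : z ∈ S) : infRatio M S * ‖z‖ ≤ ‖matE M z‖ := by
  rcases eq_or_ne z 0 with rfl | h
  · simp
  · rw [← le_div_iff₀ (norm_pos_iff.2 h)]
    refine csInf_le ⟨0, ?_⟩ ⟨z, ⟨hz, h⟩, rfl⟩
    rintro _ ⟨y, -, rfl⟩
    positivity

lemma infRatio_nonneg (S : Set (EuclideanSpace ℝ (Fin b))) : 0 ≤ infRatio M S := by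
  refine Real.sInf_nonneg ?_
  rintro _ ⟨y, -, rfl⟩
  positivity

lemma le_infRatio {S : Set (EuclideanSpace ℝ (Fin b))} {c : ℝ} (hS : ∃ z ∈ S, z ≠ 0)
    (h : ∀ z ∈ S, z ≠ 0 → c ≤ ‖matE M z‖ / ‖z‖) : c ≤ infRatio M S := by
  obtain ⟨z, hz, hz0⟩ := hS
  refine le_csInf ⟨_, z, ⟨hz, hz0⟩, rfl⟩ ?_
  rintro _ ⟨y, ⟨hy, hy0⟩, rfl⟩
  exact h y hy hy0

lemma exists_ne_zero_of_infRatio_pos {S : Set (EuclideanSpace ℝ (Fin b))}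
    (h : 0 < infRatio M S) : ∃ z ∈ S, z ≠ 0 := by
  by_contra! H
  have : {z ∈ S | z ≠ 0} = ∅ := by
    ext z
    simpa using H z
  simp [infRatio, this] at h

lemma opN_nonneg : 0 ≤ opN M := norm_nonneg _

lemma norm_matE_le (z : EuclideanSpace ℝ (Fin b)) : ‖matE M z‖ ≤ opN M * ‖z‖ :=
  (LinearMap.toContinuousLinearMap (matE M)).le_opNorm z

lemma infRatio_pos {S : Submodule ℝ (EuclideanSpace ℝ (Fin b))} (hS : ∃ z ∈ S, z ≠ 0)
    (hker : Disjoint S (LinearMap.ker (matE M))) : 0 < infRatio M (S : Set _) := by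
  obtain ⟨K, hK, hanti⟩ := ((matE M).domRestrict S).exists_antilipschitzWith
    (LinearMap.ker_eq_bot.2 (LinearMap.injective_domRestrict_iff.2 hker))
  have hK' : (0 : ℝ) < K := hK
  refine (inv_pos.2 hK').trans_le (le_infRatio M hS fun z hz hz0 => ?_)
  have := hanti.le_mul_dist ⟨z, hz⟩ 0
  rw [map_zero, dist_zero_right, dist_zero_right] at this
  rw [le_div_iff₀ (norm_pos_iff.2 hz0), inv_mul_le_iff₀ hK']
  exact this

lemma supRatio_le {S : Set (EuclideanSpace ℝ (Fin b))} {c : ℝ} (hc : 0 ≤ c)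
    (h : ∀ z ∈ S, ‖matE M z‖ ≤ c * ‖z‖) : supRatio M S ≤ c := by
  refine Real.sSup_le ?_ hc
  rintro _ ⟨y, ⟨hy, hy0⟩, rfl⟩
  exact (div_le_iff₀ (norm_pos_iff.2 hy0)).2 (h y hy)

end Ratios

section Adjoint

variable {a b c : ℕ}

lemma matE_mul_s18 (M : Matrix (Fin a) (Fin b) ℝ) (N : Matrix (Fin b) (Fin c) ℝ)
    (x : EuclideanSpace ℝ (Fin c)) : matE (M * N) x = matE M (matE N x) := by
  simp [matE, Matrix.toLpLin_apply, Matrix.mulVec_mulVec]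

lemma matE_one (x : EuclideanSpace ℝ (Fin a)) : matE (1 : Matrix (Fin a) (Fin a) ℝ) x = x := by
  simp [matE]

lemma inner_matE_transpose (M : Matrix (Fin a) (Fin b) ℝ) (x : EuclideanSpace ℝ (Fin a))
    (y : EuclideanSpace ℝ (Fin b)) : inner ℝ (matE Mᵀ x) y = inner ℝ x (matE M y) := by
  rw [matE, ← Matrix.conjTranspose_eq_transpose_of_trivial,
    Matrix.toEuclideanLin_conjTranspose_eq_adjoint, LinearMap.adjoint_inner_left, matE]

lemma norm_matE_of_orthonormal {M : Matrix (Fin a) (Fin b) ℝ} (hM : Mᵀ * M = 1)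
    (x : EuclideanSpace ℝ (Fin b)) : ‖matE M x‖ = ‖x‖ := by
  rw [norm_eq_sqrt_real_inner, norm_eq_sqrt_real_inner, ← inner_matE_transpose, ← matE_mul_s18, hM,
    matE_one]

lemma matE_mem_ker_orthogonal (M : Matrix (Fin a) (Fin b) ℝ) (x : EuclideanSpace ℝ (Fin a)) :
    matE Mᵀ x ∈ (LinearMap.ker (matE M))ᗮ := by
  rw [Submodule.mem_orthogonal']
  intro y hy
  rw [inner_matE_transpose, LinearMap.mem_ker.1 hy, inner_zero_right]

/-- If the orthonormal columns of `V` span the row space of `M`, then `M` factors through the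
orthogonal projection `V Vᵀ`. -/
lemma matE_row_space_projection {M : Matrix (Fin a) (Fin b) ℝ} {V : Matrix (Fin b) (Fin c) ℝ}
    (hV : Vᵀ * V = 1) (hrange : LinearMap.range (matE V) = LinearMap.range (matE Mᵀ))
    (z : EuclideanSpace ℝ (Fin b)) : matE M (matE V (matE Vᵀ z)) = matE M z := by
  rw [← sub_eq_zero, ← map_sub, ← inner_self_eq_zero (𝕜 := ℝ), ← inner_matE_transpose]
  obtain ⟨t, ht⟩ : matE Mᵀ (matE M (matE V (matE Vᵀ z) - z)) ∈ LinearMap.range (matE V) := by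
    rw [hrange]
    exact LinearMap.mem_range_self _ _
  rw [← ht, real_inner_comm, ← inner_matE_transpose, map_sub, ← matE_mul_s18, hV, matE_one, sub_self,
    inner_zero_left]

end Adjoint

/-- With `U₁`, `V₁` having orthonormal columns spanning `R(A)` and `R(Aᵀ)`:
(i) for nonzero `z ∈ R(A)`, `‖A z‖/‖z‖ ≥ σ_min(V₁ᵀU₁) · inf_{0 ≠ w ∈ N(A)^⊥} ‖A w‖/‖w‖`;
(ii) `sup_{0 ≠ z ∈ R(A)} ‖A z‖/‖z‖ ≤ ‖A‖·‖V₁ᵀU₁‖. Hence if `A` is GP and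
`σ_min(V₁ᵀU₁) > 0`, the condition number of the restriction of `A` to `R(A)` is at most
`κ(A)·κ(V₁ᵀU₁)`. -/
theorem gp_restriction_condition_number_bound {n r : ℕ}
    (A : Matrix (Fin n) (Fin n) ℝ)
    (hrank : Module.finrank ℝ (LinearMap.range (matE A)) = r)
    (U₁ V₁ : Matrix (Fin n) (Fin r) ℝ)
    (hU : U₁ᵀ * U₁ = 1) (hV : V₁ᵀ * V₁ = 1)
    (hUrange : LinearMap.range (matE U₁) = LinearMap.range (matE A))
    (hVrange : LinearMap.range (matE V₁) = LinearMap.range (matE Aᵀ)) :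
    (∀ z ∈ LinearMap.range (matE A), z ≠ 0 →
      infRatio (V₁ᵀ * U₁) Set.univ * infRatio A ((LinearMap.ker (matE A))ᗮ : Set _) ≤
        ‖matE A z‖ / ‖z‖) ∧
    supRatio A (LinearMap.range (matE A) : Set _) ≤ opN A * opN (V₁ᵀ * U₁) ∧
    (LinearMap.ker (matE A) ⊓ LinearMap.range (matE A) = ⊥ →
      0 < infRatio (V₁ᵀ * U₁) Set.univ →
      supRatio A (LinearMap.range (matE A) : Set _) /
          infRatio A (LinearMap.range (matE A) : Set _) ≤
        (opN A / infRatio A ((LinearMap.ker (matE A))ᗮ : Set _)) *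
          (opN (V₁ᵀ * U₁) / infRatio (V₁ᵀ * U₁) Set.univ)) := by
  have hfactor : ∀ z ∈ LinearMap.range (matE A), ∃ w x,
      x ∈ (LinearMap.ker (matE A))ᗮ ∧ ‖w‖ = ‖z‖ ∧ matE A x = matE A z ∧
        ‖x‖ = ‖matE (V₁ᵀ * U₁) w‖ := by
    intro z hz
    obtain ⟨w, rfl⟩ := hUrange ▸ hz
    refine ⟨w, matE V₁ (matE V₁ᵀ (matE U₁ w)), ?_, (norm_matE_of_orthonormal hU w).symm,
      matE_row_space_projection hV hVrange _, ?_⟩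
    · obtain ⟨y, hy⟩ := hVrange ▸ LinearMap.mem_range_self (matE V₁) (matE V₁ᵀ (matE U₁ w))
      exact hy ▸ matE_mem_ker_orthogonal A y
    · rw [norm_matE_of_orthonormal hV, matE_mul_s18]
  have hlower : ∀ z ∈ LinearMap.range (matE A), z ≠ 0 →
      infRatio (V₁ᵀ * U₁) Set.univ * infRatio A ((LinearMap.ker (matE A))ᗮ : Set _) ≤
        ‖matE A z‖ / ‖z‖ := by
    intro z hz hz0
    obtain ⟨w, x, hx, hwz, hxz, hxw⟩ := hfactor z hz
    rw [le_div_iff₀ (norm_pos_iff.2 hz0), ← hxz, ← hwz]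
    have hw := infRatio_mul_norm_le (V₁ᵀ * U₁) (Set.mem_univ w)
    have hA := infRatio_nonneg A ((LinearMap.ker (matE A))ᗮ : Set _)
    calc _ = infRatio A ((LinearMap.ker (matE A))ᗮ : Set _) *
          (infRatio (V₁ᵀ * U₁) Set.univ * ‖w‖) := by ring
      _ ≤ infRatio A ((LinearMap.ker (matE A))ᗮ : Set _) * ‖x‖ := by rw [hxw]; gcongr
      _ ≤ ‖matE A x‖ := infRatio_mul_norm_le A hx
  have hupper : supRatio A (LinearMap.range (matE A) : Set _) ≤ opN A * opN (V₁ᵀ * U₁) := by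
    refine supRatio_le A (mul_nonneg (opN_nonneg _) (opN_nonneg _)) fun z hz => ?_
    obtain ⟨w, x, -, hwz, hxz, hxw⟩ := hfactor z hz
    have hA := opN_nonneg A
    calc ‖matE A z‖ ≤ opN A * ‖x‖ := hxz ▸ norm_matE_le A x
      _ ≤ opN A * (opN (V₁ᵀ * U₁) * ‖w‖) := by rw [hxw]; gcongr; exact norm_matE_le _ w
      _ = opN A * opN (V₁ᵀ * U₁) * ‖z‖ := by rw [hwz, mul_assoc]
  refine ⟨hlower, hupper, fun hGP hσ => ?_⟩
  obtain ⟨w, -, hw0⟩ := exists_ne_zero_of_infRatio_pos _ hσ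
  have hz : matE U₁ w ∈ LinearMap.range (matE A) := hUrange ▸ LinearMap.mem_range_self _ w
  have hz0 : matE U₁ w ≠ 0 := by
    rwa [← norm_ne_zero_iff, norm_matE_of_orthonormal hU, norm_ne_zero_iff]
  obtain ⟨-, x, hx, -, hxz, -⟩ := hfactor _ hz
  have hx0 : x ≠ 0 := by
    rintro rfl
    have : matE U₁ w ∈ LinearMap.ker (matE A) ⊓ LinearMap.range (matE A) :=
      ⟨LinearMap.mem_ker.2 (by rw [← hxz, map_zero]), hz⟩
    exact hz0 (by simpa [hGP] using this)
  have hm : 0 < infRatio A ((LinearMap.ker (matE A))ᗮ : Set _) :=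
    infRatio_pos A ⟨x, hx, hx0⟩ (Submodule.orthogonal_disjoint _).symm
  rw [div_mul_div_comm, mul_comm (infRatio A _)]
  exact div_le_div₀ (mul_nonneg (opN_nonneg _) (opN_nonneg _)) hupper (mul_pos hσ hm)
    (le_infRatio A ⟨_, hz, hz0⟩ hlower)
end
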